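/- Let X ∈ ℝ^{n×k}, σ > 0, and define μ_X = (1/k)·X𝟙_k ∈ ℝ^n and C_X = (1/k)·(X − μ_X𝟙_kᵀ)(X − μ_X𝟙_kᵀ)ᵀ ∈ ℝ^{n×n}. Then C_X + σ²I_n is positive definite (hence invertible), and the function (Θ, β) ↦ ‖ΘX − X + β𝟙_kᵀ‖_F² + k·σ²·‖Θ‖_F² on ℝ^{n×n} × ℝ^n attains its global minimum at Θ̂ = C_X(C_X + σ²I_n)⁻¹ and β̂ = (I_n − Θ̂)μ_X; that is, for every Θ ∈ ℝ^{n×n} and β ∈ ℝ^n, the objective at (Θ̂, β̂) is less than or equal to the objective at (Θ, β). -/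

import Mathlib

open Matrix

/-- Squared Frobenius norm of a real matrix. -/
noncomputable def frobSq {n k : ℕ} (M : Matrix (Fin n) (Fin k) ℝ) : ℝ :=
  ∑ i, ∑ j, (M i j) ^ 2

/-- The all-ones vector `𝟙_k`. -/
def onesVec (k : ℕ) : Fin k → ℝ := fun _ => 1

theorem frobSq_eq_trace {n k : ℕ} (M : Matrix (Fin n) (Fin k) ℝ) :
    frobSq M = (M * Mᵀ).trace := by
  simp [frobSq, trace, mul_apply, sq]

theorem frobSq_nonneg {n k : ℕ} (M : Matrix (Fin n) (Fin k) ℝ) : 0 ≤ frobSq M :=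
  Finset.sum_nonneg fun _ _ => Finset.sum_nonneg fun _ _ => sq_nonneg _

theorem frobSq_add {n k : ℕ} (A B : Matrix (Fin n) (Fin k) ℝ) :
    frobSq (A + B) = frobSq A + frobSq B + 2 * (A * Bᵀ).trace := by
  have h : (B * Aᵀ).trace = (A * Bᵀ).trace := by
    rw [← trace_transpose, transpose_mul, transpose_transpose]
  simp only [frobSq_eq_trace, transpose_add, Matrix.add_mul, Matrix.mul_add, trace_add, h]
  ring

theorem sub_vecMulVec_mean_mulVec_ones {n k : ℕ} (hk : 0 < k) (X : Matrix (Fin n) (Fin k) ℝ) :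
    (X - vecMulVec ((k : ℝ)⁻¹ • X.mulVec (onesVec k)) (onesVec k)).mulVec (onesVec k) = 0 := by
  have hk' : (k : ℝ) ≠ 0 := by positivity
  ext i
  simp [mulVec, dotProduct, vecMulVec_apply, onesVec, hk']

theorem frobSq_mul_add_vecMulVec_ones {n k : ℕ} (A : Matrix (Fin n) (Fin n) ℝ)
    {Y : Matrix (Fin n) (Fin k) ℝ} (hY : Y.mulVec (onesVec k) = 0) (γ : Fin n → ℝ) :
    frobSq (A * Y + vecMulVec γ (onesVec k)) =
      frobSq (A * Y) + frobSq (vecMulVec γ (onesVec k)) := by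
  rw [frobSq_add, transpose_vecMulVec, Matrix.mul_assoc, mul_vecMulVec, hY]
  simp

theorem posDef_covariance_add {n k : ℕ} (Y : Matrix (Fin n) (Fin k) ℝ) {σ : ℝ} (hσ : 0 < σ) :
    ((k : ℝ)⁻¹ • (Y * Yᵀ) + σ ^ 2 • (1 : Matrix (Fin n) (Fin n) ℝ)).PosDef := by
  have h : (Y * Yᵀ).PosSemidef := by
    simpa using posSemidef_self_mul_conjTranspose Y
  exact PosDef.posSemidef_add (h.smul (by positivity)) (PosDef.one.smul (by positivity))

theorem ridge_le {n k : ℕ} (Y : Matrix (Fin n) (Fin k) ℝ) {c : ℝ} (hc : 0 ≤ c)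
    {T : Matrix (Fin n) (Fin n) ℝ} (hT : (T - 1) * (Y * Yᵀ) + c • T = 0)
    (Θ : Matrix (Fin n) (Fin n) ℝ) :
    frobSq ((T - 1) * Y) + c * frobSq T ≤ frobSq ((Θ - 1) * Y) + c * frobSq Θ := by
  obtain ⟨D, rfl⟩ : ∃ D, Θ = T + D := ⟨Θ - T, by abel⟩
  have h : ((T - 1) * Y * (D * Y)ᵀ).trace + c * (T * Dᵀ).trace = 0 := by
    have := congrArg (fun M => (M * Dᵀ).trace) hT
    simpa [Matrix.add_mul, Matrix.mul_assoc] using this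
  have e : (T + D - 1) * Y = (T - 1) * Y + D * Y := by
    rw [← Matrix.add_mul]; congr 1; abel
  rw [e, frobSq_add, frobSq_add]
  have := frobSq_nonneg (D * Y)
  have := mul_nonneg hc (frobSq_nonneg D)
  linarith

theorem stmt12 (n k : ℕ) (hk : 0 < k) (X : Matrix (Fin n) (Fin k) ℝ) (σ : ℝ) (hσ : 0 < σ) :
    let μX : Fin n → ℝ := (k : ℝ)⁻¹ • X.mulVec (onesVec k)
    let CX : Matrix (Fin n) (Fin n) ℝ :=
      (k : ℝ)⁻¹ • ((X - vecMulVec μX (onesVec k)) * (X - vecMulVec μX (onesVec k))ᵀ)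
    let Θh : Matrix (Fin n) (Fin n) ℝ := CX * (CX + σ ^ 2 • (1 : Matrix (Fin n) (Fin n) ℝ))⁻¹
    let βh : Fin n → ℝ := ((1 : Matrix (Fin n) (Fin n) ℝ) - Θh).mulVec μX
    (CX + σ ^ 2 • (1 : Matrix (Fin n) (Fin n) ℝ)).PosDef ∧
    ∀ (Θ : Matrix (Fin n) (Fin n) ℝ) (β : Fin n → ℝ),
      frobSq (Θh * X - X + vecMulVec βh (onesVec k)) + k * σ ^ 2 * frobSq Θh ≤
        frobSq (Θ * X - X + vecMulVec β (onesVec k)) + k * σ ^ 2 * frobSq Θ := by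
  intro μX CX Θh βh
  set Y := X - vecMulVec μX (onesVec k) with hYdef
  have hk' : (k : ℝ) ≠ 0 := by positivity
  have hY : Y.mulVec (onesVec k) = 0 := sub_vecMulVec_mean_mulVec_ones hk X
  have hpd : (CX + σ ^ 2 • (1 : Matrix (Fin n) (Fin n) ℝ)).PosDef := posDef_covariance_add Y hσ
  refine ⟨hpd, fun Θ β => ?_⟩
  have hC : Y * Yᵀ = (k : ℝ) • CX := by
    simp only [CX, smul_smul, mul_inv_cancel₀ hk', one_smul, Y]
  have hΘ : Θh * (CX + σ ^ 2 • (1 : Matrix (Fin n) (Fin n) ℝ)) = CX :=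
    nonsing_inv_mul_cancel_right _ _ ((isUnit_iff_isUnit_det _).1 hpd.isUnit)
  have hopt : (Θh - 1) * (Y * Yᵀ) + ((k : ℝ) * σ ^ 2) • Θh = 0 := by
    have : Θh * CX + σ ^ 2 • Θh = CX := by simpa [Matrix.mul_add] using hΘ
    rw [hC, Matrix.mul_smul, mul_smul, ← smul_add, Matrix.sub_mul, Matrix.one_mul,
      sub_add_eq_add_sub, this, sub_self, smul_zero]
  have hdecomp (T : Matrix (Fin n) (Fin n) ℝ) (b : Fin n → ℝ) :
      T * X - X + vecMulVec b (onesVec k) =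
        (T - 1) * Y + vecMulVec (b - (1 - T).mulVec μX) (onesVec k) := by
    rw [hYdef, Matrix.mul_sub, mul_vecMulVec, sub_vecMulVec, Matrix.sub_mul, Matrix.one_mul,
      ← neg_sub 1 T, neg_mulVec, neg_vecMulVec]
    abel
  rw [hdecomp Θh βh, hdecomp Θ β, frobSq_mul_add_vecMulVec_ones _ hY,
    frobSq_mul_add_vecMulVec_ones _ hY]
  have hzero : frobSq (vecMulVec (βh - (1 - Θh).mulVec μX) (onesVec k)) = 0 := by
    simp [βh, frobSq]
  have := frobSq_nonneg (vecMulVec (β - (1 - Θ).mulVec μX) (onesVec k))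
  have := ridge_le Y (by positivity) hopt Θ
  linarith
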